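/- Fix probability vectors p = (p_w, p_d, p_ℓ) and q = (q_w, q_d, q_ℓ), and assume Player 1 is weak, i.e. p_w ≤ p_ℓ and q_w ≤ q_ℓ, with q_d ≥ p_d. If q_ℓ ≥ p_w, then for every horizon N ≥ 1 the optimal gain satisfies g*_N ≤ 0. -/

import Mathlib

noncomputable section

open Filter Topology Finset

/-- The sign of an integer score, as a real number (`sgn 0 = 0`). -/
def sgn (x : ℤ) : ℝ := if 0 < x then 1 else if x < 0 then -1 else 0

/-- Expected sign of the score after one more game played with win/draw/loss
probabilities `w, d, l`, starting from score `x`. -/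
def stepVal (w d l : ℝ) (x : ℤ) : ℝ := w * sgn (x + 1) + d * sgn x + l * sgn (x - 1)

/-- Bellman value function with `k` games remaining: `bellman p q k x = V_{N-k}^N(x)`.
With no game remaining the value is the sign of the score; otherwise Player 1 picks the
better of the offensive style `(pw, pd, pl)` and the defensive style `(qw, qd, ql)`. -/
def bellman (pw pd pl qw qd ql : ℝ) : ℕ → ℤ → ℝ
  | 0, x => sgn x
  | k + 1, x =>
      max
        (pw * bellman pw pd pl qw qd ql k (x + 1) + pd * bellman pw pd pl qw qd ql k x +
          pl * bellman pw pd pl qw qd ql k (x - 1))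
        (qw * bellman pw pd pl qw qd ql k (x + 1) + qd * bellman pw pd pl qw qd ql k x +
          ql * bellman pw pd pl qw qd ql k (x - 1))

/-- Optimal gain over `N` games: `g*_N = V_0^N(0)`. -/
def gOpt (pw pd pl qw qd ql : ℝ) (N : ℕ) : ℝ := bellman pw pd pl qw qd ql N 0

/-- The two playing styles of Player 1. -/
inductive Style
  | offense
  | defense
deriving DecidableEq

/-- Selects the probability attached to a style: `a` for offense, `b` for defense. -/
def styleP (a b : ℝ) : Style → ℝ
  | .offense => a
  | .defense => b

/-- Probability mass function of the score process `X_n` under the policy `π`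
(playing `π n x` at round `n+1` when the current score is `x`), started at `X_0 = 0`. -/
def polDist (pw pd pl qw qd ql : ℝ) (π : ℕ → ℤ → Style) : ℕ → ℤ → ℝ
  | 0, x => if x = 0 then 1 else 0
  | n + 1, x =>
      polDist pw pd pl qw qd ql π n (x - 1) * styleP pw qw (π n (x - 1)) +
      polDist pw pd pl qw qd ql π n x * styleP pd qd (π n x) +
      polDist pw pd pl qw qd ql π n (x + 1) * styleP pl ql (π n (x + 1))

/-- Gain of policy `π` over `n` games: `g_n^π = E[sign (X_n)]`. -/
def gPol (pw pd pl qw qd ql : ℝ) (π : ℕ → ℤ → Style) (n : ℕ) : ℝ :=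
  ∑' x : ℤ, polDist pw pd pl qw qd ql π n x * sgn x

/-- Probability mass function of the pair (score, switched-to-defense flag) under the
catenaccio policy: play offense until the score first reaches `+1`, then defense forever. -/
def catDist (pw pd pl qw qd ql : ℝ) : ℕ → ℤ → Bool → ℝ
  | 0, x, b => if x = 0 ∧ b = false then 1 else 0
  | n + 1, x, true =>
      catDist pw pd pl qw qd ql n (x - 1) true * qw +
      catDist pw pd pl qw qd ql n x true * qd +
      catDist pw pd pl qw qd ql n (x + 1) true * ql +
      (if x = 1 then
        catDist pw pd pl qw qd ql n 0 false * pw +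
        catDist pw pd pl qw qd ql n 1 false * pd +
        catDist pw pd pl qw qd ql n 2 false * pl
       else 0)
  | n + 1, x, false =>
      if x = 1 then 0
      else
        catDist pw pd pl qw qd ql n (x - 1) false * pw +
        catDist pw pd pl qw qd ql n x false * pd +
        catDist pw pd pl qw qd ql n (x + 1) false * pl

/-- Gain of the catenaccio policy over `N` games: `g_N^(cat) = E[sign (X_N)]`. -/
def gCat (pw pd pl qw qd ql : ℝ) (N : ℕ) : ℝ :=
  ∑' x : ℤ,
    (catDist pw pd pl qw qd ql N x false + catDist pw pd pl qw qd ql N x true) * sgn x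

/-- Gain of the catenaccio+ policy over `N` games: play catenaccio, except that if the
score after `N - 1` games is `0`, the last game is played with the better of the two
styles (offense if `pw - pl > qw - ql`, defense otherwise). -/
def gCatPlus (pw pd pl qw qd ql : ℝ) : ℕ → ℝ
  | 0 => 0
  | N + 1 =>
      ∑' x : ℤ,
        (catDist pw pd pl qw qd ql N x false *
            (if x = 0 then (if pw - pl > qw - ql then pw - pl else qw - ql)
             else stepVal pw pd pl x) +
          catDist pw pd pl qw qd ql N x true *
            (if x = 0 then (if pw - pl > qw - ql then pw - pl else qw - ql)
             else stepVal qw qd ql x))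

/-- Probability mass function of the lazy random walk with i.i.d. increments (+1 with
probability `qw`, 0 with probability `qd`, −1 with probability `ql`), started at `0`. -/
def walkDist (qw qd ql : ℝ) : ℕ → ℤ → ℝ
  | 0, x => if x = 0 then 1 else 0
  | n + 1, x =>
      walkDist qw qd ql n (x - 1) * qw + walkDist qw qd ql n x * qd +
        walkDist qw qd ql n (x + 1) * ql

/-- Fixed-style gain over `N` games for the walk with step law `(qw, qd, ql)`. -/
def gFixed (qw qd ql : ℝ) (N : ℕ) : ℝ := ∑' x : ℤ, walkDist qw qd ql N x * sgn x

/-- Probability mass function of the lazy random walk with step law `(pw, pd, pl)`,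
started at `0` and absorbed (stopped) at the level `+1`.  In particular
`stoppedDist pw pd pl n 1` is the probability that the walk reaches `+1` by time `n`. -/
def stoppedDist (pw pd pl : ℝ) : ℕ → ℤ → ℝ
  | 0, x => if x = 0 then 1 else 0
  | n + 1, x =>
      if x = 1 then
        stoppedDist pw pd pl n 1 + stoppedDist pw pd pl n 0 * pw +
          stoppedDist pw pd pl n 2 * pl
      else
        (if x - 1 = 1 then 0 else stoppedDist pw pd pl n (x - 1) * pw) +
          stoppedDist pw pd pl n x * pd +
          (if x + 1 = 1 then 0 else stoppedDist pw pd pl n (x + 1) * pl)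
lemma sgn_mono : Monotone sgn := by
  intro x y h
  unfold sgn
  split_ifs <;> first | omega | norm_num

lemma sgn_add_sgn_neg (x : ℤ) : sgn x + sgn (-x) = 0 := by
  unfold sgn
  split_ifs <;> first | omega | norm_num

/-- The Bellman value function is monotone in the score. -/
lemma bellman_monotone {pw pd pl qw qd ql : ℝ}
    (hpw : 0 ≤ pw) (hpd : 0 ≤ pd) (hpl : 0 ≤ pl)
    (hqw : 0 ≤ qw) (hqd : 0 ≤ qd) (hql : 0 ≤ ql) (k : ℕ) :
    Monotone (bellman pw pd pl qw qd ql k) := by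
  induction k with
  | zero => exact sgn_mono
  | succ k ih =>
    intro x y h
    have h1 := ih (show x + 1 ≤ y + 1 by omega)
    have h2 := ih h
    have h3 := ih (show x - 1 ≤ y - 1 by omega)
    simp only [bellman]
    gcongr

/-- If the law `(aw, ad, al)` is stochastically dominated by the reflection of
`(bw, bd, bl)`, then playing the former at `x` and the latter at `-x` preserves the
inequality `V x + V (-x) ≤ 0`. -/
lemma step_add_step_neg_nonpos {V : ℤ → ℝ} (hV : Monotone V) (hS : ∀ x, V x + V (-x) ≤ 0)
    {aw ad al bw bd bl : ℝ} (haw : 0 ≤ aw) (had : 0 ≤ ad) (ha : aw + ad + al = 1)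
    (hbw : 0 ≤ bw) (hb : bw + bd + bl = 1) (hab : aw ≤ bl) (hba : bw ≤ al) (x : ℤ) :
    (aw * V (x + 1) + ad * V x + al * V (x - 1)) +
      (bw * V (-x + 1) + bd * V (-x) + bl * V (-x - 1)) ≤ 0 := by
  have hup := hS (x + 1)
  have hdown := hS (x - 1)
  rw [show -(x + 1) = -x - 1 by ring] at hup
  rw [show -(x - 1) = -x + 1 by ring] at hdown
  have h1 : V (x - 1) ≤ V x := hV (by omega)
  have h2 : V (-x - 1) ≤ V (-x) := hV (by omega)
  obtain rfl : ad = 1 - aw - al := by linarith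
  obtain rfl : bd = 1 - bw - bl := by linarith
  have e1 := mul_nonneg (sub_nonneg.2 hab) (sub_nonneg.2 h2)
  have e2 := mul_nonneg (sub_nonneg.2 hba) (sub_nonneg.2 h1)
  have e3 := mul_nonpos_of_nonneg_of_nonpos haw hup
  have e4 := mul_nonpos_of_nonneg_of_nonpos hbw hdown
  have e5 := mul_nonpos_of_nonneg_of_nonpos (show 0 ≤ 1 - aw - bw by linarith) (hS x)
  linarith

/-- If Player 1 is weak (`pw ≤ pl`, `qw ≤ ql`), defense draws more
(`pd ≤ qd`), and `ql ≥ pw`, then the optimal gain satisfies `g*_N ≤ 0` for all `N ≥ 1`. -/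
theorem gOpt_nonpos_of_weak
    (pw pd pl qw qd ql : ℝ)
    (hpw : 0 ≤ pw) (hpd : 0 ≤ pd) (hpl : 0 ≤ pl) (hp : pw + pd + pl = 1)
    (hqw : 0 ≤ qw) (hqd : 0 ≤ qd) (hql : 0 ≤ ql) (hq : qw + qd + ql = 1)
    (hweakp : pw ≤ pl) (hweakq : qw ≤ ql) (hdef : pd ≤ qd) (hcond : pw ≤ ql)
    (N : ℕ) (hN : 1 ≤ N) :
    gOpt pw pd pl qw qd ql N ≤ 0 := by
  have hpq : qw ≤ pl := by linarith
  have key : ∀ k x, bellman pw pd pl qw qd ql k x + bellman pw pd pl qw qd ql k (-x) ≤ 0 := by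
    intro k
    induction k with
    | zero => exact fun x => (sgn_add_sgn_neg x).le
    | succ k ih =>
      intro x
      have hV := bellman_monotone hpw hpd hpl hqw hqd hql k
      have hpp := step_add_step_neg_nonpos hV ih hpw hpd hp hpw hp hweakp hweakp x
      have hpq' := step_add_step_neg_nonpos hV ih hpw hpd hp hqw hq hcond hpq x
      have hqp := step_add_step_neg_nonpos hV ih hqw hqd hq hpw hp hpq hcond x
      have hqq := step_add_step_neg_nonpos hV ih hqw hqd hq hqw hq hweakq hweakq x
      simp only [bellman]
      rw [← le_neg_iff_add_nonpos_right]
      refine max_le ?_ ?_ <;> rw [le_neg] <;> refine max_le ?_ ?_ <;> linarith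
  have h := key N 0
  rw [neg_zero] at h
  unfold gOpt
  linarith
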